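/- Let n be a positive integer. Define B_{n,k}(a) = (1-q^n) ∑_{h=1}^{n-k} (-1)^h [n-k-1 choose h-1]_q [k+h-1 choose h-1]_q q^{h(h-1)/2 + kh} a^h / (1-q^h). Then, as an identity in the field of rational functions Q(q, a, x): (x;q)_n + (a/x;q)_n = (x;q)_n (a/x;q)_n + (a;q)_n + ∑_{k=1}^{n-1} (x;q)_k (a/x;q)_k B_{n,k}(a). -/

import Mathlib

open Finset

/-- The q-Pochhammer symbol `(a;q)_n = ∏_{j=0}^{n-1} (1 - a q^j)`. -/
noncomputable def qPoch {F : Type*} [Field F] (q a : F) (n : ℕ) : F :=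
  ∏ j ∈ Finset.range n, (1 - a * q ^ j)

/-- The q-binomial coefficient `[n choose k]_q`, which is
`(q;q)_n / ((q;q)_k (q;q)_{n-k})` for `0 ≤ k ≤ n` and `0` otherwise. -/
noncomputable def qBin {F : Type*} [Field F] (q : F) (n k : ℕ) : F :=
  if k ≤ n then qPoch q q n / (qPoch q q k * qPoch q q (n - k)) else 0

/-- The field of rational functions `ℚ(q, a, x)`. -/
abbrev F3 : Type := FractionRing (MvPolynomial (Fin 3) ℚ)

noncomputable def q : F3 := algebraMap (MvPolynomial (Fin 3) ℚ) F3 (MvPolynomial.X 0)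
noncomputable def a : F3 := algebraMap (MvPolynomial (Fin 3) ℚ) F3 (MvPolynomial.X 1)
noncomputable def x : F3 := algebraMap (MvPolynomial (Fin 3) ℚ) F3 (MvPolynomial.X 2)

/-- `B_{n,k}(a)` from the statement. -/
noncomputable def B (n k : ℕ) : F3 :=
  (1 - q ^ n) * ∑ h ∈ Finset.Icc 1 (n - k),
    (-1 : F3) ^ h * qBin q (n - k - 1) (h - 1) * qBin q (k + h - 1) (h - 1) *
      q ^ (h * (h - 1) / 2 + k * h) * a ^ h / (1 - q ^ h)

section aux
set_option linter.unusedSimpArgs false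

variable {F : Type*} [Field F]

lemma qPoch_succ' (q a : F) (n : ℕ) : qPoch q a (n+1) = qPoch q a n * (1 - a * q ^ n) := by
  simp [qPoch, Finset.prod_range_succ]

lemma qPoch_zero' (q a : F) : qPoch q a 0 = 1 := by simp [qPoch]

noncomputable def pp (q : F) (m h : ℕ) : F := qPoch q q (m+h) / (qPoch q q h * qPoch q q m)

lemma qPoch_ne (q : F) (hq : ∀ j : ℕ, 1 - q ^ (j+1) ≠ 0) (n : ℕ) : qPoch q q n ≠ 0 := by
  induction n with
  | zero => simp [qPoch_zero']
  | succ n ih =>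
    rw [qPoch_succ', ← pow_succ']
    exact mul_ne_zero ih (hq n)

lemma pp_zero (q : F) (hq : ∀ j : ℕ, 1 - q ^ (j+1) ≠ 0) (h : ℕ) : pp q 0 h = 1 := by
  have := qPoch_ne q hq h
  simp [pp, qPoch_zero', this]

lemma pp_m (q : F) (hq : ∀ j : ℕ, 1 - q ^ (j+1) ≠ 0) (m h : ℕ) :
    pp q (m+1) h = pp q m h * (1 - q^(m+h+1)) / (1 - q^(m+1)) := by
  have h1 := qPoch_ne q hq h
  have h2 := qPoch_ne q hq m
  have h3 := hq m
  unfold pp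
  rw [show m+1+h = (m+h)+1 by ring, qPoch_succ', qPoch_succ', ← pow_succ', ← pow_succ']
  field_simp

lemma pp_one (q : F) (hq : ∀ j : ℕ, 1 - q ^ (j+1) ≠ 0) (h : ℕ) :
    pp q 1 h = (1 - q^(h+1)) / (1 - q) := by
  have := pp_m q hq 0 h
  simpa [pp_zero q hq] using this

lemma pp_h (q : F) (hq : ∀ j : ℕ, 1 - q ^ (j+1) ≠ 0) (m h : ℕ) :
    pp q m (h+1) = pp q m h * (1 - q^(m+h+1)) / (1 - q^(h+1)) := by
  have h1 := qPoch_ne q hq h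
  have h2 := qPoch_ne q hq m
  have h3 := hq h
  unfold pp
  rw [show m+(h+1) = (m+h)+1 by ring, qPoch_succ', qPoch_succ', ← pow_succ', ← pow_succ']
  field_simp

noncomputable def GG (q : F) (k m h : ℕ) : F :=
  (-1)^(h+1) * ((1 - q^(k+m+h+1)) / (1 - q^(h+1))) * q^((h+1)*h/2 + k*(h+1)) * pp q m h * pp q k h

noncomputable def bb (q : F) (n k : ℕ) : ℕ → F
  | 0 => (if n = k then 1 else 0) + (if k = 0 then 1 else 0)
  | h+1 => if k+h+1 ≤ n then GG q k (n-k-h-1) h else 0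

lemma bb_succ (q : F) (n k h m : ℕ) (e : n = k+h+1+m) : bb q n k (h+1) = GG q k m h := by
  subst e
  simp only [bb]
  rw [if_pos (by omega)]
  congr 1; omega

lemma bb_zero_of (q : F) (n k h : ℕ) (e : n < k+h+1) : bb q n k (h+1) = 0 := by
  simp only [bb]
  rw [if_neg (by omega)]

lemma tri (h : ℕ) : (h+2)*(h+1)/2 = (h+1)*h/2 + (h+1) := by
  rw [show (h+2)*(h+1) = (h+1)*h + (h+1)*2 by ring]
  omega


set_option maxHeartbeats 4000000 in
lemma rec_k_hh (q : F) (hq : ∀ j : ℕ, 1 - q ^ (j+1) ≠ 0) (n k h : ℕ) :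
    q^(k+1) * bb q (n+2) (k+1) (h+2) = q^(k+1)*(1+q)*bb q (n+1) (k+1) (h+2)
      - q^(k+2) * bb q n (k+1) (h+2) - q^(2*n+2+k) * bb q n (k+1) (h+1)
      - q^(n+1) * (bb q (n+1) (k+1) (h+2) - bb q n (k+1) (h+2))
      - q^(n+3+2*k) * (bb q (n+1) (k+1) (h+1) - bb q n (k+1) (h+1))
      + q^(n+2) * (bb q (n+1) k (h+2) - bb q n k (h+2)) := by
  have e1 := hq h
  have e2 := hq (h+1)
  have e3 := hq k
  rcases lt_or_ge n (k+h+1) with hn | hn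
  · rw [bb_zero_of _ _ _ _ (by omega), bb_zero_of _ _ _ _ (by omega), bb_zero_of _ _ _ _ (by omega),
      bb_zero_of _ _ _ _ (by omega), bb_zero_of _ _ _ _ (by omega), bb_zero_of _ _ _ _ (by omega),
      bb_zero_of _ _ _ _ (by omega)]
    ring
  obtain ⟨m, rfl⟩ := Nat.exists_eq_add_of_le hn
  rcases m with _ | _ | m
  · rw [bb_succ q _ (k+1) (h+1) 0 (by omega), bb_zero_of q _ (k+1) (h+1) (by omega),
      bb_zero_of q _ (k+1) (h+1) (by omega), bb_zero_of q _ (k+1) h (by omega),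
      bb_succ q _ (k+1) h 0 (by omega), bb_succ q _ k (h+1) 0 (by omega),
      bb_zero_of q _ k (h+1) (by omega)]
    simp only [GG, pp_zero q hq, pp_h q hq, pp_m q hq, tri]
    generalize (h+1)*h/2 = t
    generalize pp q k h = u
    simp only [pow_add, two_mul, mul_add, add_mul, pow_one, one_mul, mul_one, pow_zero, zero_add, add_zero, mul_zero, zero_mul] at *
    generalize q^h = H at *
    generalize q^k = K at *
    generalize q^t = T at *
    generalize q^(k*h) = KH at *
    generalize (-1:F)^h = s at *
    have f1 : 1 - q*H ≠ 0 := by convert e1 using 1; ring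
    have f2 : 1 - q^2*H ≠ 0 := by convert e2 using 1; ring
    have f3 : 1 - q*K ≠ 0 := by convert e3 using 1; ring
    field_simp
    ring
  · rw [bb_succ q _ (k+1) (h+1) 1 (by omega), bb_succ q _ (k+1) (h+1) 0 (by omega),
      bb_zero_of q _ (k+1) (h+1) (by omega), bb_succ q _ (k+1) h 0 (by omega),
      bb_succ q _ (k+1) h 1 (by omega), bb_succ q _ k (h+1) 1 (by omega),
      bb_succ q _ k (h+1) 0 (by omega)]
    have e4 := hq 0
    simp only [GG, pp_zero q hq, pp_h q hq, pp_m q hq, tri, pp_one q hq]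
    generalize (h+1)*h/2 = t
    generalize pp q k h = u
    simp only [pow_add, two_mul, mul_add, add_mul, pow_one, one_mul, mul_one, pow_zero, zero_add, add_zero, mul_zero, zero_mul] at *
    generalize q^h = H at *
    generalize q^k = K at *
    generalize q^t = T at *
    generalize q^(k*h) = KH at *
    generalize (-1:F)^h = s at *
    have f1 : 1 - q*H ≠ 0 := by convert e1 using 1; ring
    have f2 : 1 - q^2*H ≠ 0 := by convert e2 using 1; ring
    have f3 : 1 - q*K ≠ 0 := by convert e3 using 1; ring
    have f4 : 1 - q ≠ 0 := by convert e4 using 1; try ring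
    field_simp
    ring
  · rw [bb_succ q _ (k+1) (h+1) (m+2) (by omega), bb_succ q _ (k+1) (h+1) (m+1) (by omega),
      bb_succ q _ (k+1) (h+1) m (by omega), bb_succ q _ (k+1) h (m+1) (by omega),
      bb_succ q _ (k+1) h (m+2) (by omega), bb_succ q _ k (h+1) (m+2) (by omega),
      bb_succ q _ k (h+1) (m+1) (by omega)]
    have e4 := hq m
    have e5 := hq (m+1)
    simp only [GG, pp_h q hq, pp_m q hq, tri]
    generalize (h+1)*h/2 = t
    generalize pp q k h = u
    generalize pp q m h = v
    simp only [pow_add, two_mul, mul_add, add_mul, pow_one, one_mul, mul_one, pow_zero, zero_add, add_zero, mul_zero, zero_mul] at *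
    generalize q^h = H at *
    generalize q^k = K at *
    generalize q^t = T at *
    generalize q^(k*h) = KH at *
    generalize (-1:F)^h = s at *
    have f1 : 1 - q*H ≠ 0 := by convert e1 using 1; ring
    have f2 : 1 - q^2*H ≠ 0 := by convert e2 using 1; ring
    have f3 : 1 - q*K ≠ 0 := by convert e3 using 1; ring
    generalize q^m = M at *
    have f4 : 1 - q*M ≠ 0 := by convert e4 using 1; ring
    have f5 : 1 - q^2*M ≠ 0 := by convert e5 using 1; ring
    field_simp
    ring

set_option maxHeartbeats 4000000 in
lemma rec_0_hh (q : F) (hq : ∀ j : ℕ, 1 - q ^ (j+1) ≠ 0) (n h : ℕ) :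
    bb q (n+2) 0 (h+2) = (1+q)*bb q (n+1) 0 (h+2)
      - q * bb q n 0 (h+2) - q^(2*n+1) * bb q n 0 (h+1)
      - q^(n+1) * (bb q (n+1) 0 (h+2) - bb q n 0 (h+2))
      - q^(n+1) * (bb q (n+1) 0 (h+1) - bb q n 0 (h+1)) := by
  have e1 := hq h
  have e2 := hq (h+1)
  rcases lt_or_ge n h with hn | hn
  · rw [bb_zero_of _ _ _ _ (by omega), bb_zero_of _ _ _ _ (by omega), bb_zero_of _ _ _ _ (by omega),
      bb_zero_of _ _ _ _ (by omega), bb_zero_of _ _ _ _ (by omega)]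
    ring
  obtain ⟨m, rfl⟩ := Nat.exists_eq_add_of_le hn
  rcases m with _ | _ | m
  · rw [bb_succ q _ 0 (h+1) 0 (by omega), bb_zero_of q _ 0 (h+1) (by omega),
      bb_zero_of q _ 0 (h+1) (by omega), bb_zero_of q _ 0 h (by omega),
      bb_succ q _ 0 h 0 (by omega)]
    simp only [GG, pp_zero q hq, pp_h q hq, pp_m q hq, tri]
    generalize (h+1)*h/2 = t
    simp only [pow_add, two_mul, mul_add, add_mul, pow_one, one_mul, mul_one, pow_zero, zero_add, add_zero, mul_zero, zero_mul] at *
    generalize q^h = H at *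
    generalize q^t = T at *
    generalize (-1:F)^h = s at *
    have f1 : 1 - q*H ≠ 0 := by convert e1 using 1; ring
    have f2 : 1 - q^2*H ≠ 0 := by convert e2 using 1; ring
    have g2 : 1 - H*q^2 ≠ 0 := by convert e2 using 1; ring
    field_simp
    ring
  · rw [bb_succ q _ 0 (h+1) 1 (by omega), bb_succ q _ 0 (h+1) 0 (by omega),
      bb_zero_of q _ 0 (h+1) (by omega), bb_succ q _ 0 h 0 (by omega),
      bb_succ q _ 0 h 1 (by omega)]
    have e4 := hq 0
    simp only [GG, pp_zero q hq, pp_h q hq, pp_m q hq, tri, pp_one q hq]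
    generalize (h+1)*h/2 = t
    simp only [pow_add, two_mul, mul_add, add_mul, pow_one, one_mul, mul_one, pow_zero, zero_add, add_zero, mul_zero, zero_mul] at *
    generalize q^h = H at *
    generalize q^t = T at *
    generalize (-1:F)^h = s at *
    have f1 : 1 - q*H ≠ 0 := by convert e1 using 1; ring
    have f2 : 1 - q^2*H ≠ 0 := by convert e2 using 1; ring
    have g2 : 1 - H*q^2 ≠ 0 := by convert e2 using 1; ring
    have f4 : 1 - q ≠ 0 := by convert e4 using 1; try ring
    field_simp
    ring
  · rw [bb_succ q _ 0 (h+1) (m+2) (by omega), bb_succ q _ 0 (h+1) (m+1) (by omega),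
      bb_succ q _ 0 (h+1) m (by omega), bb_succ q _ 0 h (m+1) (by omega),
      bb_succ q _ 0 h (m+2) (by omega)]
    have e4 := hq m
    have e5 := hq (m+1)
    simp only [GG, pp_h q hq, pp_zero q hq, pp_m q hq, tri]
    generalize (h+1)*h/2 = t
    generalize pp q m h = v
    simp only [pow_add, two_mul, mul_add, add_mul, pow_one, one_mul, mul_one, pow_zero, zero_add, add_zero, mul_zero, zero_mul] at *
    generalize q^h = H at *
    generalize q^t = T at *
    generalize (-1:F)^h = s at *
    have f1 : 1 - q*H ≠ 0 := by convert e1 using 1; ring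
    have f2 : 1 - q^2*H ≠ 0 := by convert e2 using 1; ring
    have g2 : 1 - H*q^2 ≠ 0 := by convert e2 using 1; ring
    generalize q^m = M at *
    have f4 : 1 - q*M ≠ 0 := by convert e4 using 1; ring
    have f5 : 1 - q^2*M ≠ 0 := by convert e5 using 1; ring
    have g5 : 1 - M*q^2 ≠ 0 := by convert e5 using 1; ring
    field_simp
    ring

lemma bb_one (q : F) (hq : ∀ j : ℕ, 1 - q ^ (j+1) ≠ 0) (n k : ℕ) :
    bb q n k 1 = if k + 1 ≤ n then - ((1 - q^n)/(1-q)) * q^k else 0 := by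
  split_ifs with h
  · obtain ⟨m, rfl⟩ := Nat.exists_eq_add_of_le h
    have h1 := qPoch_ne q hq m
    have h2 := qPoch_ne q hq k
    rw [bb_succ q _ k 0 m (by omega)]
    simp [GG, pp, qPoch_zero', h1, h2]
    left; congr 3; ring
  · exact bb_zero_of _ _ _ _ (by omega)

lemma rec_0_1 (q : F) (hq : ∀ j : ℕ, 1 - q ^ (j+1) ≠ 0) (n : ℕ) :
    bb q (n+2) 0 1 = (1+q)*bb q (n+1) 0 1
      - q * bb q n 0 1 - q^(2*n+1) * bb q n 0 0
      - q^(n+1) * (bb q (n+1) 0 1 - bb q n 0 1)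
      - q^(n+1) * (bb q (n+1) 0 0 - bb q n 0 0) := by
  have f4 : 1 - q ≠ 0 := by simpa using hq 0
  simp only [bb_one q hq]
  rcases n with _ | n
  · simp [bb]
    field_simp
    ring
  · simp [bb]
    field_simp
    ring

lemma rec_k_1 (q : F) (hq : ∀ j : ℕ, 1 - q ^ (j+1) ≠ 0) (n k : ℕ) :
    q^(k+1) * bb q (n+2) (k+1) 1 = q^(k+1)*(1+q)*bb q (n+1) (k+1) 1
      - q^(k+2) * bb q n (k+1) 1 - q^(2*n+2+k) * bb q n (k+1) 0
      - q^(n+1) * (bb q (n+1) (k+1) 1 - bb q n (k+1) 1)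
      - q^(n+3+2*k) * (bb q (n+1) (k+1) 0 - bb q n (k+1) 0)
      + q^(n+2) * (bb q (n+1) k 1 - bb q n k 1) := by
  have f4 : 1 - q ≠ 0 := by simpa using hq 0
  simp only [bb_one q hq]
  rcases lt_or_ge n k with hn | hn
  · simp [bb, show ¬ (k+1+1 ≤ n+2) by omega, show ¬ (k+1+1 ≤ n+1) by omega, show ¬ (k+1+1 ≤ n) by omega,
     show ¬ (k+1 ≤ n+1) by omega, show ¬ (k+1 ≤ n) by omega, show ¬ (n = k) by omega, show ¬ (n = k+1) by omega]
  obtain ⟨m, rfl⟩ := Nat.exists_eq_add_of_le hn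
  rcases m with _ | _ | m
  · simp [bb]
    field_simp
    ring
  · simp [bb]
    field_simp
    ring
  · simp [bb, show (k+1+1 ≤ k+(m+1+1)) by omega, show (k+1+1 ≤ k+(m+1+1)+1) by omega,
      show (k+1 ≤ k+(m+1+1)) by omega, show ¬ (m + 1 + 1 = 1) by omega, show ¬ (k+(m+1+1) = k+1) by omega]
    field_simp
    ring

lemma rec_0_0 (q : F) (n : ℕ) :
    bb q (n+2) 0 0 = (1+q)*bb q (n+1) 0 0
      - q * bb q n 0 0 
      - q^(n+1) * (bb q (n+1) 0 0 - bb q n 0 0) := by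
  rcases n with _ | n
  · simp [bb]; ring
  · simp [bb]

lemma rec_k_0 (q : F) (n k : ℕ) :
    q^(k+1) * bb q (n+2) (k+1) 0 = q^(k+1)*(1+q)*bb q (n+1) (k+1) 0
      - q^(k+2) * bb q n (k+1) 0 
      - q^(n+1) * (bb q (n+1) (k+1) 0 - bb q n (k+1) 0)
      + q^(n+2) * (bb q (n+1) k 0 - bb q n k 0) := by
  simp only [bb]
  by_cases h1 : n + 1 = k
  · subst h1; simp [show ¬ n = n+1+1 by omega]; try ring
  by_cases h2 : n = k
  · subst h2; simp; ring
  by_cases h3 : n = k + 1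
  · subst h3; simp [show ¬ k+1+1 = k by omega]; try ring
  simp [h1, h2, h3]

lemma rec_k_h (q : F) (hq : ∀ j : ℕ, 1 - q ^ (j+1) ≠ 0) (n k h : ℕ) :
    q^(k+1) * bb q (n+2) (k+1) (h+1) = q^(k+1)*(1+q)*bb q (n+1) (k+1) (h+1)
      - q^(k+2) * bb q n (k+1) (h+1) - q^(2*n+2+k) * bb q n (k+1) h
      - q^(n+1) * (bb q (n+1) (k+1) (h+1) - bb q n (k+1) (h+1))
      - q^(n+3+2*k) * (bb q (n+1) (k+1) h - bb q n (k+1) h)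
      + q^(n+2) * (bb q (n+1) k (h+1) - bb q n k (h+1)) := by
  rcases h with _ | h
  · exact rec_k_1 q hq n k
  · exact rec_k_hh q hq n k h

lemma rec_0_h (q : F) (hq : ∀ j : ℕ, 1 - q ^ (j+1) ≠ 0) (n h : ℕ) :
    bb q (n+2) 0 (h+1) = (1+q)*bb q (n+1) 0 (h+1)
      - q * bb q n 0 (h+1) - q^(2*n+1) * bb q n 0 h
      - q^(n+1) * (bb q (n+1) 0 (h+1) - bb q n 0 (h+1))
      - q^(n+1) * (bb q (n+1) 0 h - bb q n 0 h) := by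
  rcases h with _ | h
  · exact rec_0_1 q hq n
  · exact rec_0_hh q hq n h

noncomputable def cc (q a : F) (n k : ℕ) : F := ∑ h ∈ range (n+1), bb q n k h * a^h

lemma cc_ext (q a : F) (n k N : ℕ) (hN : n + 1 ≤ N) :
    cc q a n k = ∑ h ∈ range N, bb q n k h * a^h := by
  unfold cc
  apply Finset.sum_subset
  · intro i hi; simp at *; omega
  · intro i _ hi
    rcases i with _ | i
    · simp at hi
    · rw [bb_zero_of _ _ _ _ (by simp at hi; omega)]; simp

lemma cc_split (q a : F) (n k N : ℕ) (hN : n ≤ N) :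
    cc q a n k = (∑ h ∈ range N, bb q n k (h+1) * a^(h+1)) + bb q n k 0 := by
  rw [cc_ext q a n k (N+1) (by omega), Finset.sum_range_succ']
  simp

lemma cc_a (q a : F) (n k N : ℕ) (hN : n + 1 ≤ N) :
    a * cc q a n k = (∑ h ∈ range N, bb q n k h * a^(h+1)) := by
  rw [cc_ext q a n k N (by omega), Finset.mul_sum]
  exact Finset.sum_congr rfl (fun _ _ => by ring)

lemma cc_zero (q a : F) (n k : ℕ) (h : n < k) : cc q a n k = 0 := by
  unfold cc
  apply Finset.sum_eq_zero
  intro i _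
  rcases i with _ | i
  · simp [bb, show ¬ n = k by omega, show ¬ k = 0 by omega]
  · rw [bb_zero_of _ _ _ _ (by omega)]; simp

lemma crec_k (q a : F) (hq : ∀ j : ℕ, 1 - q ^ (j+1) ≠ 0) (n k : ℕ) :
    q^(k+1) * cc q a (n+2) (k+1) = q^(k+1)*(1+q)*cc q a (n+1) (k+1)
      - q^(k+2) * cc q a n (k+1) - q^(2*n+2+k) * (a * cc q a n (k+1))
      - q^(n+1) * (cc q a (n+1) (k+1) - cc q a n (k+1))
      - q^(n+3+2*k) * (a * cc q a (n+1) (k+1) - a * cc q a n (k+1))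
      + q^(n+2) * (cc q a (n+1) k - cc q a n k) := by
  rw [cc_a q a n (k+1) (n+2) (by omega), cc_a q a (n+1) (k+1) (n+2) (by omega)]
  rw [cc_split q a (n+2) (k+1) (n+2) (by omega), cc_split q a (n+1) (k+1) (n+2) (by omega),
    cc_split q a n (k+1) (n+2) (by omega), cc_split q a (n+1) k (n+2) (by omega),
    cc_split q a n k (n+2) (by omega)]
  have h1 := rec_k_0 q n k
  have h2 := Finset.sum_congr (rfl : range (n+2) = range (n+2))
    (fun h _ => congrArg (· * a^(h+1)) (rec_k_h q hq n k h))
  simp only [sub_mul, add_mul, mul_sub, Finset.sum_add_distrib, Finset.sum_sub_distrib, mul_assoc,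
    ← Finset.mul_sum] at h2
  linear_combination h1 + h2

lemma crec_0 (q a : F) (hq : ∀ j : ℕ, 1 - q ^ (j+1) ≠ 0) (n : ℕ) :
    cc q a (n+2) 0 = (1+q)*cc q a (n+1) 0
      - q * cc q a n 0 - q^(2*n+1) * (a * cc q a n 0)
      - q^(n+1) * (cc q a (n+1) 0 - cc q a n 0)
      - q^(n+1) * (a * cc q a (n+1) 0 - a * cc q a n 0) := by
  rw [cc_a q a n 0 (n+2) (by omega), cc_a q a (n+1) 0 (n+2) (by omega)]
  rw [cc_split q a (n+2) 0 (n+2) (by omega), cc_split q a (n+1) 0 (n+2) (by omega),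
    cc_split q a n 0 (n+2) (by omega)]
  have h1 := rec_0_0 q n
  have h2 := Finset.sum_congr (rfl : range (n+2) = range (n+2))
    (fun h _ => congrArg (· * a^(h+1)) (rec_0_h q hq n h))
  simp only [sub_mul, add_mul, mul_sub, Finset.sum_add_distrib, Finset.sum_sub_distrib, mul_assoc,
    ← Finset.mul_sum] at h2
  linear_combination h1 + h2

lemma cc00 (q a : F) : cc q a 0 0 = 2 := by
  simp [cc, bb]; norm_num

lemma cc10 (q a : F) (hq : ∀ j : ℕ, 1 - q ^ (j+1) ≠ 0) : cc q a 1 0 = 1 - a := by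
  have f4 : 1 - q ≠ 0 := by simpa using hq 0
  simp [cc, Finset.sum_range_succ, bb_one q hq, f4]
  simp [bb]; ring

lemma cc11 (q a : F) (n : ℕ) : cc q a (n+1) (n+1) = 1 := by
  rw [cc_split q a _ _ (n+1) (by omega), Finset.sum_eq_zero]
  · simp [bb]
  · intro h _
    rw [bb_zero_of _ _ _ _ (by omega)]; simp

lemma cc_n0 (q a : F) (hq : ∀ j : ℕ, 1 - q ^ (j+1) ≠ 0) (n : ℕ) :
    cc q a (n+1) 0 = qPoch q a (n+1) ∧ cc q a (n+2) 0 = qPoch q a (n+2) := by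
  induction n with
  | zero =>
    have := crec_0 q a hq 0
    rw [this]
    simp only [zero_add, cc10 q a hq, cc00, qPoch_succ', qPoch_zero']
    constructor <;> ring
  | succ n ih =>
    refine ⟨ih.2, ?_⟩
    have := crec_0 q a hq (n+1)
    rw [this, ih.1, ih.2]
    simp only [qPoch_succ']
    ring

noncomputable def PP (q x y : F) (k : ℕ) : F := qPoch q x k * qPoch q y k

noncomputable def VV (q x y : F) (n : ℕ) : ℕ → F
  | 0 => 0
  | k+1 => q^(n+1) / q^k * (cc q (x*y) (n+1) k - cc q (x*y) n k) * PP q x y (k+1)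

lemma step (q x y : F) (hq0 : q ≠ 0) (hq : ∀ j : ℕ, 1 - q ^ (j+1) ≠ 0) (n k : ℕ) :
    (1 + q - q^(n+1)*(x+y)) * (cc q (x*y) (n+1) k * PP q x y k)
      - (q + (x*y)*q^(2*n+1) - q^(n+1)*(x+y)) * (cc q (x*y) n k * PP q x y k)
      - cc q (x*y) (n+2) k * PP q x y k = VV q x y n (k+1) - VV q x y n k := by
  have hP : PP q x y (k+1) = PP q x y k * ((1 - x*q^k)*(1-y*q^k)) := by
    simp only [PP, qPoch_succ']; ring
  have hk : q^k ≠ 0 := pow_ne_zero _ hq0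
  rcases k with _ | k
  · simp only [VV, hP, crec_0 q (x*y) hq]
    field_simp
    ring
  · have h := crec_k q (x*y) hq n k
    have hk' : q^k ≠ 0 := pow_ne_zero _ hq0
    have h' : cc q (x*y) (n+2) (k+1) = (q^(k+1)*(1+q)*cc q (x*y) (n+1) (k+1)
      - q^(k+2) * cc q (x*y) n (k+1) - q^(2*n+2+k) * (x*y * cc q (x*y) n (k+1))
      - q^(n+1) * (cc q (x*y) (n+1) (k+1) - cc q (x*y) n (k+1))
      - q^(n+3+2*k) * (x*y * cc q (x*y) (n+1) (k+1) - x*y * cc q (x*y) n (k+1))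
      + q^(n+2) * (cc q (x*y) (n+1) k - cc q (x*y) n k)) / q^(k+1) := by
      rw [eq_div_iff hk, ← h]; ring
    rw [h']
    simp only [VV, hP]
    field_simp
    ring

lemma f_ext (q x y : F) (n N : ℕ) (hN : n + 1 ≤ N) :
    ∑ k ∈ range (n+1), cc q (x*y) n k * PP q x y k = ∑ k ∈ range N, cc q (x*y) n k * PP q x y k := by
  apply Finset.sum_subset
  · intro i hi; simp at *; omega
  · intro i _ hi
    rw [cc_zero _ _ _ _ (by simp at hi; omega)]; simp

lemma main_f (q x y : F) (hq0 : q ≠ 0) (hq : ∀ j : ℕ, 1 - q ^ (j+1) ≠ 0) (n : ℕ) :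
    (qPoch q x n + qPoch q y n = ∑ k ∈ range (n+1), cc q (x*y) n k * PP q x y k) ∧
    (qPoch q x (n+1) + qPoch q y (n+1) = ∑ k ∈ range (n+2), cc q (x*y) (n+1) k * PP q x y k) := by
  induction n with
  | zero =>
    constructor
    · simp [cc00, PP, qPoch_zero']; norm_num
    · simp [Finset.sum_range_succ, cc10 q _ hq, cc11 q _ 0, PP, qPoch_zero', qPoch]; ring
  | succ n ih =>
    refine ⟨ih.2, ?_⟩
    obtain ⟨h0, h1⟩ := ih
    rw [f_ext q x y n (n+3) (by omega)] at h0
    rw [f_ext q x y (n+1) (n+3) (by omega)] at h1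
    have h2 := Finset.sum_congr (rfl : range (n+3) = range (n+3))
      (fun k _ => step q x y hq0 hq n k)
    rw [Finset.sum_range_sub] at h2
    simp only [Finset.sum_sub_distrib, ← Finset.mul_sum] at h2
    rw [← h0, ← h1] at h2
    have h3 : VV q x y n (n+3) = 0 := by
      simp [VV, cc_zero q (x*y) (n+1) (n+2) (by omega), cc_zero q (x*y) n (n+2) (by omega)]
    have h4 : VV q x y n 0 = 0 := rfl
    rw [h3, h4] at h2
    simp only [qPoch_succ'] at h2 ⊢
    linear_combination h2

end aux

lemma q_ne : q ≠ 0 := by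
  unfold q
  intro h
  rw [map_eq_zero_iff _ (IsFractionRing.injective _ _)] at h
  exact MvPolynomial.X_ne_zero _ h

lemma x_ne : x ≠ 0 := by
  unfold x
  intro h
  rw [map_eq_zero_iff _ (IsFractionRing.injective _ _)] at h
  exact MvPolynomial.X_ne_zero _ h

lemma q_pow (j : ℕ) : 1 - q^(j+1) ≠ 0 := by
  unfold q
  intro h
  rw [← map_pow, ← map_one (algebraMap (MvPolynomial (Fin 3) ℚ) F3), ← map_sub,
    map_eq_zero_iff _ (IsFractionRing.injective _ _)] at h
  have := congrArg (MvPolynomial.eval (fun _ => (0:ℚ))) h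
  simp at this

lemma cc_B (n k : ℕ) (hk : 1 ≤ k) (hkn : k < n) : cc q a n k = B n k := by
  obtain ⟨d, rfl⟩ := Nat.exists_eq_add_of_lt hkn
  rw [cc_split q a _ k _ le_rfl]
  have h0 : bb q (k+d+1) k 0 = 0 := by
    simp [bb, show ¬ k + d + 1 = k by omega, show ¬ k = 0 by omega]
  rw [h0, add_zero]
  have h1 : ∑ h ∈ range (d+1), bb q (k+d+1) k (h+1) * a^(h+1)
      = ∑ h ∈ range (k+d+1), bb q (k+d+1) k (h+1) * a^(h+1) := by
    apply Finset.sum_subset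
    · intro i hi; simp at *; omega
    · intro i _ hi
      rw [bb_zero_of _ _ _ _ (by simp at hi; omega)]; simp
  rw [← h1, B, show k + d + 1 - k = d + 1 by omega, Finset.range_eq_Ico,
    Finset.sum_Ico_add' (fun h => bb q (k+d+1) k h * a^h) 0 (d+1) 1, Finset.mul_sum]
  apply Finset.sum_congr
  · ext i; simp; try omega
  intro h hh
  simp at hh
  obtain ⟨h, rfl⟩ := Nat.exists_eq_add_of_le' hh.1
  obtain ⟨m, rfl⟩ := Nat.exists_eq_add_of_le (show h ≤ d by omega)
  rw [bb_succ q _ k h m (by omega)]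
  simp only [GG, qBin, pp]
  rw [if_pos (by omega), if_pos (by omega)]
  simp only [show h + m + 1 - 1 = m + h by omega, show h + 1 - 1 = h by omega,
    show m + h - h = m by omega, show k + (h+1) - 1 = k + h by omega, show k + h - h = k by omega,
    show k + (h + m) + 1 = k + m + h + 1 by omega]
  ring

theorem qPoch_add_decomposition (n : ℕ) (hn : 0 < n) :
    qPoch q x n + qPoch q (a / x) n =
      qPoch q x n * qPoch q (a / x) n + qPoch q a n +
        ∑ k ∈ Finset.Icc 1 (n - 1), qPoch q x k * qPoch q (a / x) k * B n k := by
  obtain ⟨n, rfl⟩ := Nat.exists_eq_add_of_le' hn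
  have hxa : x * (a / x) = a := mul_div_cancel₀ _ x_ne
  rw [(main_f q x (a/x) q_ne q_pow n).2, hxa, Finset.sum_range_succ, Finset.sum_range_succ',
    (cc_n0 q a q_pow n).1, cc11]
  have h1 : ∑ k ∈ range n, cc q a (n+1) (k+1) * PP q x (a/x) (k+1)
      = ∑ k ∈ Finset.Icc 1 (n + 1 - 1), qPoch q x k * qPoch q (a / x) k * B (n+1) k := by
    rw [Finset.range_eq_Ico,
      Finset.sum_Ico_add' (fun k => cc q a (n+1) k * PP q x (a/x) k) 0 n 1]
    apply Finset.sum_congr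
    · ext i; simp; try omega
    intro k hk
    simp at hk
    rw [cc_B (n+1) k (by omega) (by omega), PP]
    ring
  rw [h1]
  simp only [PP, qPoch_zero']
  ring
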